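/- Assume λ₀ > 0. For each of the three sensing schemes — singlets (T₁=T₂=T₃=T₄=T/4, other times 0, output (Y₁,…,Y₄)), pairs (T₅=⋯=T₁₀=T/6, other times 0, output (Y₅,…,Y₁₀)), and triplets (T₁₁=⋯=T₁₄=T/4, other times 0, output (Y₁₁,…,Y₁₄)) — the mutual information between X and the corresponding output vector converges to H(X₁,X₂,X₃,X₄), the Shannon entropy of X, as T → ∞. -/

import Mathlib

open MeasureTheory ProbabilityTheory Real Filter

noncomputable section

/-- Shannon entropy of a measure: the sum of `-q * log q` over the normalized
masses of singletons (Mathlib-style `measureEntropy`). -/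
def measureEntropy {S : Type*} [MeasurableSpace S] (μ : Measure S) : ℝ :=
  ∑' s, Real.negMulLog (((μ Set.univ)⁻¹ • μ) {s}).toReal

/-- Mutual information of a joint law on a product space:
`I(X;Y) = H(X) + H(Y) - H(X,Y)`. -/
def measureMutualInfo {S U : Type*} [MeasurableSpace S] [MeasurableSpace U]
    (μ : Measure (S × U)) : ℝ :=
  measureEntropy (μ.map Prod.fst) + measureEntropy (μ.map Prod.snd) - measureEntropy μ

/-- The 15 nonempty subsets of `{1,2,3,4}` (coded as `Fin 4`), in the paper's order:
`S₁={1}, S₂={2}, S₃={3}, S₄={4}, S₅={1,2}, S₆={1,3}, S₇={1,4}, S₈={2,3}, S₉={2,4},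
S₁₀={3,4}, S₁₁={1,2,3}, S₁₂={1,2,4}, S₁₃={1,3,4}, S₁₄={2,3,4}, S₁₅={1,2,3,4}`. -/
def sens : Fin 15 → Finset (Fin 4) :=
  ![{0}, {1}, {2}, {3}, {0,1}, {0,2}, {0,3}, {1,2}, {1,3}, {2,3},
    {0,1,2}, {0,1,3}, {0,2,3}, {1,2,3}, {0,1,2,3}]

/-- Law of one input component: `λ₁` with probability `p`, `λ₀` with probability `1-p`. -/
def inputLaw (p lam0 lam1 : ℝ) : Measure ℝ :=
  ENNReal.ofReal p • Measure.dirac lam1 + ENNReal.ofReal (1 - p) • Measure.dirac lam0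

/-- Law of the input vector `X = (X₁,X₂,X₃,X₄)` with i.i.d. components. -/
def XLaw (p lam0 lam1 : ℝ) : Measure (Fin 4 → ℝ) :=
  Measure.pi fun _ => inputLaw p lam0 lam1

/-- Poisson distribution on `ℕ` with (nonnegative) real rate `r`;
rate `0` gives the Dirac mass at `0`. -/
def poissonMeasure (r : ℝ) : Measure ℕ :=
  (poissonPMF r.toNNReal).toMeasure

/-- Joint law of `(X, (Y_{idx 1}, …, Y_{idx k}))` in the vector Poisson channel:
conditionally on `X = x`, the indicated outputs are independent with
`Y_i ~ Poisson (T i * ∑_{j ∈ Sᵢ} x j)`. -/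
def poissonJointLaw (p lam0 lam1 : ℝ) (T : Fin 15 → ℝ) {k : ℕ} (idx : Fin k → Fin 15) :
    Measure ((Fin 4 → ℝ) × (Fin k → ℕ)) :=
  (XLaw p lam0 lam1).bind fun x =>
    (Measure.pi fun i => poissonMeasure (T (idx i) * ∑ j ∈ sens (idx i), x j)).map
      (fun y => (x, y))

theorem sqrt_sum_le_sum_sqrt {ι : Type*} (s : Finset ι) (f : ι → ℝ) :
    √(∑ i ∈ s, f i) ≤ ∑ i ∈ s, √(f i) := by
  refine Finset.le_sum_of_subadditive _ Real.sqrt_zero.le (fun x y => ?_) s f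
  have h (z : ℝ) : z ≤ √z ^ 2 := by
    rcases le_total 0 z with hz | hz
    · rw [Real.sq_sqrt hz]
    · exact hz.trans (sq_nonneg _)
  refine Real.sqrt_le_iff.2 ⟨by positivity, ?_⟩
  nlinarith [h x, h y, mul_nonneg (Real.sqrt_nonneg x) (Real.sqrt_nonneg y)]

theorem negMulLog_le_two_mul_sqrt {u : ℝ} (hu : 0 ≤ u) : negMulLog u ≤ 2 * √u := by
  rcases hu.eq_or_lt with rfl | hu
  · simp
  have hs : 0 < √u := Real.sqrt_pos.2 hu
  have hlog : log (√u)⁻¹ ≤ (√u)⁻¹ - 1 := Real.log_le_sub_one_of_pos (inv_pos.2 hs)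
  have hu2 : u = √u * √u := (Real.mul_self_sqrt hu.le).symm
  rw [Real.log_inv] at hlog
  have hlogu : log u = 2 * log √u := by rw [Real.log_sqrt hu.le]; ring
  calc negMulLog u = u * (2 * (-log √u)) := by rw [negMulLog, hlogu]; ring
    _ ≤ u * (2 * (√u)⁻¹) := by gcongr; linarith
    _ = 2 * √u := by
      nth_rewrite 1 [hu2]
      field_simp

theorem log_one_add_le_sqrt {t : ℝ} (ht : 0 ≤ t) : log (1 + t) ≤ √t := by
  have hs : 0 ≤ √t := Real.sqrt_nonneg t
  have hsq : √t ^ 2 = t := Real.sq_sqrt ht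
  rw [Real.log_le_iff_le_exp (by positivity)]
  have h := Real.sum_le_exp_of_nonneg hs 4
  simp only [Finset.sum_range_succ, Finset.sum_range_zero, Nat.factorial] at h
  norm_num at h
  nlinarith [mul_nonneg hs (sq_nonneg (√t - 3 / 2))]

/-- For nonnegative weights, the conditional-entropy contribution of a single outcome. -/
theorem sum_negMulLog_sub_negMulLog_sum {ι : Type*} (s : Finset ι) (u : ι → ℝ) :
    ∑ x ∈ s, negMulLog (u x) - negMulLog (∑ x ∈ s, u x)
      = ∑ x ∈ s, u x * (log (∑ z ∈ s, u z) - log (u x)) := by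
  simp only [negMulLog, mul_sub, Finset.sum_sub_distrib, ← Finset.sum_mul, neg_mul,
    Finset.sum_neg_distrib]
  ring

theorem negMulLog_sum_le_sum_negMulLog {ι : Type*} (s : Finset ι) (u : ι → ℝ)
    (hu : ∀ x ∈ s, 0 ≤ u x) :
    negMulLog (∑ x ∈ s, u x) ≤ ∑ x ∈ s, negMulLog (u x) := by
  rw [← sub_nonneg, sum_negMulLog_sub_negMulLog_sum]
  refine Finset.sum_nonneg fun x hx => ?_
  rcases (hu x hx).eq_or_lt with h | h
  · simp [← h]
  · exact mul_nonneg h.le (sub_nonneg.2 (Real.log_le_log h (Finset.single_le_sum hu hx)))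

theorem sum_negMulLog_sub_negMulLog_sum_le {ι : Type*} [DecidableEq ι] (s : Finset ι)
    (u : ι → ℝ) (hu : ∀ x ∈ s, 0 ≤ u x) :
    ∑ x ∈ s, negMulLog (u x) - negMulLog (∑ x ∈ s, u x)
      ≤ ∑ x ∈ s, ∑ z ∈ s.erase x, √(u x * u z) := by
  rw [sum_negMulLog_sub_negMulLog_sum]
  refine Finset.sum_le_sum fun x hx => ?_
  rcases (hu x hx).eq_or_lt with h | h
  · simp [← h]
  set r := ∑ z ∈ s.erase x, u z with hr
  have hr0 : 0 ≤ r := Finset.sum_nonneg fun z hz => hu z (Finset.mem_of_mem_erase hz)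
  have hsum : ∑ z ∈ s, u z = u x + r := (Finset.add_sum_erase s u hx).symm
  have hlog : log (u x + r) - log (u x) = log (1 + r / u x) := by
    rw [← Real.log_div (by positivity) h.ne']
    congr 1
    field_simp
  calc u x * (log (∑ z ∈ s, u z) - log (u x))
      ≤ u x * √(r / u x) := by
        rw [hsum, hlog]
        gcongr
        exact log_one_add_le_sqrt (by positivity)
    _ = √(u x * r) := by
        rw [← Real.sqrt_sq (mul_nonneg h.le (Real.sqrt_nonneg _)), mul_pow,
          Real.sq_sqrt (by positivity)]
        congr 1
        field_simp
    _ ≤ ∑ z ∈ s.erase x, √(u x * u z) := by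
        rw [hr, Finset.mul_sum]
        exact sqrt_sum_le_sum_sqrt _ _

section FiniteInput

variable {S B : Type*} [MeasurableSpace S] [MeasurableSingletonClass S] {μ : Measure S}
  {A : Finset S}

theorem aemeasurable_of_restrict_finset_eq {β : Type*} [MeasurableSpace β]
    (hA : μ.restrict A = μ) (f : S → β) : AEMeasurable f μ := by
  have hU : (A : Set S) = ⋃ a : A, {(a : S)} := by ext; simp
  rw [← hA, hU, aemeasurable_iUnion_iff]
  intro a
  rw [Measure.restrict_singleton]
  exact aemeasurable_dirac.smul_measure _

theorem measure_singleton_eq_zero_of_notMem (hA : μ.restrict A = μ) {x : S} (hx : x ∉ A) :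
    μ {x} = 0 := by
  rw [← hA, Measure.restrict_apply (measurableSet_singleton x)]
  simp [hx]

theorem measureEntropy_eq_tsum_real {α : Type*} [MeasurableSpace α] (κ : Measure α)
    [IsProbabilityMeasure κ] : measureEntropy κ = ∑' a, negMulLog (κ.real {a}) := by
  simp [measureEntropy, Measure.real]

variable [MeasurableSpace B] {ν : S → Measure B}

theorem bind_map_prodMk_apply (hA : μ.restrict A = μ) {s : Set (S × B)} (hs : MeasurableSet s) :
    (μ.bind fun x => (ν x).map (fun y => (x, y))) s
      = ∑ a ∈ A, ν a (Prod.mk a ⁻¹' s) * μ {a} := by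
  rw [Measure.bind_apply hs (aemeasurable_of_restrict_finset_eq hA _)]
  simp_rw [fun x => Measure.map_apply (μ := ν x) (measurable_prodMk_left (x := x)) hs]
  conv_lhs => rw [← hA]
  exact lintegral_finset A _

theorem summable_negMulLog_mul_real {w : ℝ} (hw0 : 0 ≤ w) (hw1 : w ≤ 1) {κ : Measure B}
    [IsProbabilityMeasure κ] (hs : Summable fun y => √(κ.real {y})) :
    Summable fun y => negMulLog (w * κ.real {y}) := by
  refine Summable.of_nonneg_of_le (fun y => ?_) (fun y => ?_) (hs.mul_left 2)
  · exact negMulLog_nonneg (by positivity) (mul_le_one₀ hw1 (by positivity) measureReal_le_one)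
  · refine (negMulLog_le_two_mul_sqrt (by positivity)).trans ?_
    gcongr
    exact mul_le_of_le_one_left (by positivity) hw1

theorem real_bind_map_prodMk_singleton [MeasurableSingletonClass B] (hA : μ.restrict A = μ)
    (x : S) (y : B) :
    (μ.bind fun x => (ν x).map (fun y => (x, y))).real {(x, y)}
      = μ.real {x} * (ν x).real {y} := by
  classical
  rw [Measure.real, bind_map_prodMk_apply hA (measurableSet_singleton _)]
  have h : ∀ a, Prod.mk a ⁻¹' {(x, y)} = if a = x then {y} else (∅ : Set B) := by
    intro a
    ext b
    by_cases hax : a = x <;> simp [hax]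
  by_cases hx : x ∈ A
  · rw [Finset.sum_eq_single x]
    · simp [h, Measure.real, mul_comm]
    · intro a _ hax
      simp [h, hax]
    · simp [hx]
  · rw [Finset.sum_eq_zero]
    · simp [Measure.real, measure_singleton_eq_zero_of_notMem hA hx]
    · intro a ha
      have : a ≠ x := fun hax => hx (hax ▸ ha)
      simp [h, this]

variable [∀ x, IsProbabilityMeasure (ν x)]

theorem map_fst_bind_map_prodMk (hA : μ.restrict A = μ) :
    (μ.bind fun x => (ν x).map (fun y => (x, y))).map Prod.fst = μ := by
  ext s hs
  rw [Measure.map_apply measurable_fst hs,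
    Measure.bind_apply (measurable_fst hs) (aemeasurable_of_restrict_finset_eq hA _)]
  have h : ∀ x, (ν x).map (fun y => (x, y)) (Prod.fst ⁻¹' s) = s.indicator 1 x := by
    intro x
    rw [Measure.map_apply measurable_prodMk_left (measurable_fst hs)]
    by_cases hx : x ∈ s <;> simp [Set.preimage_preimage, hx]
  simp_rw [h]
  exact lintegral_indicator_one hs

variable [IsProbabilityMeasure μ]

theorem isProbabilityMeasure_bind_map_prodMk (hA : μ.restrict A = μ) :
    IsProbabilityMeasure (μ.bind fun x => (ν x).map (fun y => (x, y))) := by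
  constructor
  rw [bind_map_prodMk_apply hA MeasurableSet.univ]
  simp only [Set.preimage_univ, measure_univ, one_mul]
  rw [sum_measure_singleton, ← Measure.restrict_apply_univ, hA, measure_univ]

variable [MeasurableSingletonClass B]

theorem real_map_snd_bind_map_prodMk_singleton (hA : μ.restrict A = μ) (y : B) :
    ((μ.bind fun x => (ν x).map (fun y => (x, y))).map Prod.snd).real {y}
      = ∑ x ∈ A, μ.real {x} * (ν x).real {y} := by
  rw [Measure.real, Measure.map_apply measurable_snd (measurableSet_singleton y),
    bind_map_prodMk_apply hA (measurable_snd (measurableSet_singleton y)),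
    ENNReal.toReal_sum fun a _ => by finiteness]
  refine Finset.sum_congr rfl fun x _ => ?_
  rw [ENNReal.toReal_mul, mul_comm, Set.preimage_preimage]
  rfl

theorem measureEntropy_bind_map_prodMk (hA : μ.restrict A = μ)
    (hs : ∀ x, Summable fun y => √((ν x).real {y})) :
    measureEntropy (μ.bind fun x => (ν x).map (fun y => (x, y)))
      = ∑ x ∈ A, ∑' y, negMulLog (μ.real {x} * (ν x).real {y}) := by
  have := isProbabilityMeasure_bind_map_prodMk (ν := ν) hA
  rw [measureEntropy_eq_tsum_real]
  have hinj : Function.Injective (Prod.map (Subtype.val : A → S) (id : B → B)) :=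
    Subtype.val_injective.prodMap Function.injective_id
  rw [← hinj.tsum_eq]
  · have hsum : ∀ x : A, Summable fun y => negMulLog (μ.real {(x : S)} * (ν x).real {y}) :=
      fun x => summable_negMulLog_mul_real (by positivity) measureReal_le_one (hs x)
    simp only [Prod.map_apply', id, real_bind_map_prodMk_singleton hA]
    rw [Summable.tsum_prod' _ hsum, tsum_fintype,
      Finset.sum_coe_sort A fun x => ∑' y, negMulLog (μ.real {x} * (ν x).real {y})]
    rw [summable_prod_of_nonneg]
    · exact ⟨hsum, .of_finite⟩
    · intro z
      exact negMulLog_nonneg (by positivity)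
        (mul_le_one₀ measureReal_le_one (by positivity) measureReal_le_one)
  · rintro ⟨x, y⟩ hxy
    by_cases hx : x ∈ A
    · exact ⟨(⟨x, hx⟩, y), rfl⟩
    · refine absurd ?_ hxy
      simp only [real_bind_map_prodMk_singleton hA]
      simp [Measure.real, measure_singleton_eq_zero_of_notMem hA hx]

/-- The mutual information of a finite-input channel falls short of the input entropy by at most
the sum of the Bhattacharyya coefficients of pairs of distinct inputs. -/
theorem abs_measureMutualInfo_sub_measureEntropy_le [DecidableEq S] (hA : μ.restrict A = μ)
    (hs : ∀ x, Summable fun y => √((ν x).real {y})) :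
    |measureMutualInfo (μ.bind fun x => (ν x).map (fun y => (x, y))) - measureEntropy μ|
      ≤ ∑ x ∈ A, ∑ z ∈ A.erase x, ∑' y, √((ν x).real {y} * (ν z).real {y}) := by
  have := isProbabilityMeasure_bind_map_prodMk (ν := ν) hA
  have : IsProbabilityMeasure
      ((μ.bind fun x => (ν x).map (fun y => (x, y))).map Prod.snd) :=
    Measure.isProbabilityMeasure_map measurable_snd.aemeasurable
  set P : S → B → ℝ := fun x y => μ.real {x} * (ν x).real {y} with hP
  have hP0 : ∀ x y, 0 ≤ P x y := fun x y => by positivity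
  have hjoint : ∀ x, Summable fun y => negMulLog (P x y) := fun x =>
    summable_negMulLog_mul_real (by positivity) measureReal_le_one (hs x)
  have hBsum : ∀ x z, Summable fun y => √((ν x).real {y} * (ν z).real {y}) := fun x z => by
    refine Summable.of_nonneg_of_le (fun y => by positivity) (fun y => ?_) (hs x)
    gcongr
    exact mul_le_of_le_one_right (by positivity) measureReal_le_one
  have hjointA : Summable fun y => ∑ x ∈ A, negMulLog (P x y) :=
    summable_sum fun x _ => hjoint x
  have hlower : ∀ y, 0 ≤ negMulLog (∑ x ∈ A, P x y) := fun y => by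
    rw [hP, ← real_map_snd_bind_map_prodMk_singleton hA]
    exact negMulLog_nonneg (by positivity) measureReal_le_one
  have hupper : ∀ y, negMulLog (∑ x ∈ A, P x y) ≤ ∑ x ∈ A, negMulLog (P x y) := fun y =>
    negMulLog_sum_le_sum_negMulLog A _ fun x _ => hP0 x y
  have hout : Summable fun y => negMulLog (∑ x ∈ A, P x y) :=
    Summable.of_nonneg_of_le hlower hupper hjointA
  have hMI : measureMutualInfo (μ.bind fun x => (ν x).map (fun y => (x, y)))
      - measureEntropy μ
      = -∑' y, (∑ x ∈ A, negMulLog (P x y) - negMulLog (∑ x ∈ A, P x y)) := by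
    rw [measureMutualInfo, map_fst_bind_map_prodMk hA, measureEntropy_bind_map_prodMk hA hs,
      measureEntropy_eq_tsum_real (Measure.map _ _), hjointA.tsum_sub hout,
      Summable.tsum_finsetSum fun x _ => hjoint x]
    simp_rw [real_map_snd_bind_map_prodMk_singleton hA]
    ring
  rw [hMI, abs_neg, abs_of_nonneg (tsum_nonneg fun y => sub_nonneg.2 (hupper y))]
  have hBsumA : ∀ x ∈ A, Summable fun y =>
      ∑ z ∈ A.erase x, √((ν x).real {y} * (ν z).real {y}) :=
    fun x _ => summable_sum fun z _ => hBsum x z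
  calc _ ≤ ∑' y, ∑ x ∈ A, ∑ z ∈ A.erase x, √((ν x).real {y} * (ν z).real {y}) := by
        refine (hjointA.sub hout).tsum_le_tsum (fun y => ?_) (summable_sum hBsumA)
        refine (sum_negMulLog_sub_negMulLog_sum_le A _ fun x _ => hP0 x y).trans ?_
        gcongr with x _ z _
        · exact mul_le_of_le_one_left (by positivity) measureReal_le_one
        · exact mul_le_of_le_one_left (by positivity) measureReal_le_one
    _ = _ := by
        rw [Summable.tsum_finsetSum hBsumA]
        exact Finset.sum_congr rfl fun x _ => Summable.tsum_finsetSum fun z _ => hBsum x z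

end FiniteInput

section Poisson

open scoped Nat

instance (r : ℝ) : IsProbabilityMeasure (_root_.poissonMeasure r) :=
  inferInstanceAs (IsProbabilityMeasure (PMF.toMeasure _))

theorem poissonMeasure_real_singleton_eq (r : ℝ) (n : ℕ) :
    (_root_.poissonMeasure r).real {n}
      = exp (-(r.toNNReal : ℝ)) * (r.toNNReal : ℝ) ^ n / n ! := by
  rw [Measure.real, _root_.poissonMeasure,
    PMF.toMeasure_apply_singleton _ _ (measurableSet_singleton n)]
  have h : 0 ≤ exp (-(r.toNNReal : ℝ)) * (r.toNNReal : ℝ) ^ n / n ! := by positivity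
  exact ENNReal.toReal_ofReal h

theorem hasSum_sqrt_poissonMeasure_mul (r s : ℝ) :
    HasSum (fun n => √((_root_.poissonMeasure r).real {n} * (_root_.poissonMeasure s).real {n}))
      (exp (-((√r - √s) ^ 2 / 2))) := by
  have hmax (t : ℝ) : √t ^ 2 = (t.toNNReal : ℝ) := by
    rcases le_total 0 t with ht | ht
    · rw [Real.sq_sqrt ht, Real.coe_toNNReal _ ht]
    · simp [Real.sqrt_eq_zero_of_nonpos ht, Real.toNNReal_of_nonpos ht]
  have hexp := (NormedSpace.expSeries_div_hasSum_exp (√r * √s)).mul_left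
    (exp (-((√r ^ 2 + √s ^ 2) / 2)))
  rw [← Real.exp_eq_exp_ℝ, ← Real.exp_add] at hexp
  have hval : -((√r - √s) ^ 2 / 2) = -((√r ^ 2 + √s ^ 2) / 2) + √r * √s := by ring
  rw [hval]
  refine (congrArg (HasSum · _) (funext fun n => ?_)).mpr hexp
  rw [poissonMeasure_real_singleton_eq, poissonMeasure_real_singleton_eq, ← hmax, ← hmax,
    Real.sqrt_eq_iff_mul_self_eq (by positivity) (by positivity)]
  have h : exp (-((√r ^ 2 + √s ^ 2) / 2)) * exp (-((√r ^ 2 + √s ^ 2) / 2))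
      = exp (-√r ^ 2) * exp (-√s ^ 2) := by
    rw [← Real.exp_add, ← Real.exp_add]
    ring_nf
  symm
  calc _ = (exp (-((√r ^ 2 + √s ^ 2) / 2)) * exp (-((√r ^ 2 + √s ^ 2) / 2)))
        * ((√r * √s) ^ n / n !) ^ 2 := by ring
    _ = _ := by rw [h]; ring

theorem summable_sqrt_poissonMeasure (r : ℝ) :
    Summable fun n => √((_root_.poissonMeasure r).real {n}) := by
  refine Summable.of_nonneg_of_le (fun n => by positivity) (fun n => ?_)
    ((Real.summable_pow_div_factorial (2 * (r.toNNReal : ℝ))).add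
      (summable_geometric_of_lt_one (by norm_num : (0 : ℝ) ≤ 1 / 2) (by norm_num)))
  rw [poissonMeasure_real_singleton_eq]
  set a : ℝ := (r.toNNReal : ℝ)
  have ha : 0 ≤ a := NNReal.coe_nonneg _
  have h1 : exp (-a) ≤ 1 := Real.exp_le_one_iff.2 (neg_nonpos.2 ha)
  have hx : 0 ≤ (2 * a) ^ n / (n ! : ℝ) := by positivity
  have hy : 0 ≤ (1 / 2 : ℝ) ^ n := by positivity
  refine Real.sqrt_le_iff.2 ⟨by positivity, ?_⟩
  calc exp (-a) * a ^ n / n ! ≤ 1 * a ^ n / n ! := by gcongr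
    _ = (2 * a) ^ n / (n ! : ℝ) * (1 / 2 : ℝ) ^ n := by
        rw [mul_pow, div_mul_eq_mul_div, mul_right_comm, ← mul_pow]
        norm_num
    _ ≤ _ := by nlinarith

theorem hasSum_mul_of_nonneg {B C : Type*} {f : B → ℝ} {g : C → ℝ} {a b : ℝ}
    (hf : HasSum f a) (hg : HasSum g b) (hf0 : ∀ x, 0 ≤ f x) (hg0 : ∀ y, 0 ≤ g y) :
    HasSum (fun z : B × C => f z.1 * g z.2) (a * b) :=
  hf.mul hg (hf.summable.mul_of_nonneg hg.summable hf0 hg0)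

theorem hasSum_prod_fin {B : Type*} {k : ℕ} {f : Fin k → B → ℝ} {a : Fin k → ℝ}
    (hf : ∀ i, HasSum (f i) (a i)) (hf0 : ∀ i b, 0 ≤ f i b) :
    HasSum (fun y : Fin k → B => ∏ i, f i (y i)) (∏ i, a i) := by
  induction k with
  | zero => simp
  | succ k ih =>
    have htail := ih (fun i => hf i.succ) fun i => hf0 i.succ
    have hprod := hasSum_mul_of_nonneg (hf 0) htail (hf0 0) fun y =>
      Finset.prod_nonneg fun i _ => hf0 i.succ (y i)
    rw [Fin.prod_univ_succ, ← (Fin.consEquiv fun _ => B).hasSum_iff]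
    convert hprod using 2
    simp [Fin.consEquiv, Fin.prod_univ_succ]

theorem real_pi_poissonMeasure_singleton {k : ℕ} (r : Fin k → ℝ) (y : Fin k → ℕ) :
    (Measure.pi fun i => _root_.poissonMeasure (r i)).real {y}
      = ∏ i, (_root_.poissonMeasure (r i)).real {y i} := by
  simp [Measure.real, Measure.pi_singleton, ENNReal.toReal_prod]

theorem summable_sqrt_pi_poissonMeasure {k : ℕ} (r : Fin k → ℝ) :
    Summable fun y => √((Measure.pi fun i => _root_.poissonMeasure (r i)).real {y}) := by
  simp_rw [real_pi_poissonMeasure_singleton]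
  refine (hasSum_prod_fin (fun i => (summable_sqrt_poissonMeasure (r i)).hasSum)
    fun i n => by positivity).summable.congr fun y => ?_
  rw [Real.sqrt_prod]
  exact fun i _ => by positivity

/-- The Bhattacharyya coefficient of two products of Poisson laws. -/
theorem tsum_sqrt_pi_poissonMeasure_mul {k : ℕ} (r s : Fin k → ℝ) :
    ∑' y, √((Measure.pi fun i => _root_.poissonMeasure (r i)).real {y}
        * (Measure.pi fun i => _root_.poissonMeasure (s i)).real {y})
      = exp (-∑ i, (√(r i) - √(s i)) ^ 2 / 2) := by
  rw [← Finset.sum_neg_distrib, Real.exp_sum]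
  refine HasSum.tsum_eq ?_
  convert hasSum_prod_fin (fun i => hasSum_sqrt_poissonMeasure_mul (r i) (s i))
    (fun i n => by positivity) using 2 with y
  rw [real_pi_poissonMeasure_singleton, real_pi_poissonMeasure_singleton,
    ← Finset.prod_mul_distrib, Real.sqrt_prod]
  exact fun i _ => by positivity

theorem tendsto_exp_neg_sum_sqrt_mul {k : ℕ} {u v : Fin k → ℝ} (hu : ∀ i, 0 ≤ u i)
    (hv : ∀ i, 0 ≤ v i) (huv : u ≠ v) :
    Tendsto (fun t : ℝ => exp (-∑ i, (√(t * u i) - √(t * v i)) ^ 2 / 2)) atTop (nhds 0) := by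
  have hpos : 0 < ∑ i, (√(u i) - √(v i)) ^ 2 / 2 := by
    obtain ⟨i, hi⟩ := Function.ne_iff.1 huv
    refine Finset.sum_pos' (fun i _ => by positivity) ⟨i, Finset.mem_univ i, ?_⟩
    have : √(u i) - √(v i) ≠ 0 :=
      sub_ne_zero.2 fun h => hi ((Real.sqrt_inj (hu i) (hv i)).1 h)
    positivity
  refine (Real.tendsto_exp_neg_atTop_nhds_zero.comp
    (tendsto_id.atTop_mul_const hpos)).congr' ?_
  filter_upwards [eventually_ge_atTop 0] with t ht
  simp only [Function.comp, id, Finset.mul_sum]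
  congr 2
  refine Finset.sum_congr rfl fun i _ => ?_
  rw [Real.sqrt_mul ht, Real.sqrt_mul ht, ← mul_sub, mul_pow, Real.sq_sqrt ht]
  ring

end Poisson

section Sensing

theorem isProbabilityMeasure_inputLaw {p : ℝ} (hp0 : 0 < p) (hp1 : p < 1) (lam0 lam1 : ℝ) :
    IsProbabilityMeasure (inputLaw p lam0 lam1) := by
  constructor
  simp only [inputLaw, Measure.add_apply, Measure.smul_apply, measure_univ, smul_eq_mul, mul_one]
  rw [← ENNReal.ofReal_add hp0.le (by linarith)]
  simp

/-- The possible values of the input vector. -/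
def inputSupport (lam0 lam1 : ℝ) : Finset (Fin 4 → ℝ) :=
  Fintype.piFinset fun _ => {lam0, lam1}

theorem XLaw_restrict_inputSupport {p : ℝ} (hp0 : 0 < p) (hp1 : p < 1) (lam0 lam1 : ℝ) :
    (XLaw p lam0 lam1).restrict (inputSupport lam0 lam1) = XLaw p lam0 lam1 := by
  have := isProbabilityMeasure_inputLaw hp0 hp1 lam0 lam1
  have : IsProbabilityMeasure (XLaw p lam0 lam1) := by unfold XLaw; infer_instance
  refine Measure.restrict_eq_self_of_ae_mem ?_
  change (inputSupport lam0 lam1 : Set (Fin 4 → ℝ)) ∈ ae (XLaw p lam0 lam1)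
  rw [mem_ae_iff_prob_eq_one (Finset.measurableSet _), inputSupport, Fintype.coe_piFinset, XLaw,
    Measure.pi_pi]
  refine Finset.prod_eq_one fun i _ => ?_
  have h : inputLaw p lam0 lam1 Set.univ = 1 := measure_univ
  simpa [inputLaw] using h

theorem tendsto_measureMutualInfo_poissonJointLaw {p lam0 lam1 : ℝ} (hlam0 : 0 < lam0)
    (hlam : lam0 < lam1) (hp0 : 0 < p) (hp1 : p < 1) {k : ℕ} (idx : Fin k → Fin 15)
    (times : ℝ → Fin 15 → ℝ) {c : ℝ} (hc : 0 < c) (htimes : ∀ T i, times T (idx i) = T / c)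
    (hinj : ∀ x z : Fin 4 → ℝ,
      (∀ i, ∑ j ∈ sens (idx i), x j = ∑ j ∈ sens (idx i), z j) → x = z) :
    Tendsto (fun T => measureMutualInfo (poissonJointLaw p lam0 lam1 (times T) idx)) atTop
      (nhds (measureEntropy (XLaw p lam0 lam1))) := by
  have := isProbabilityMeasure_inputLaw hp0 hp1 lam0 lam1
  have : IsProbabilityMeasure (XLaw p lam0 lam1) := by unfold XLaw; infer_instance
  have hnonneg : ∀ x ∈ inputSupport lam0 lam1, ∀ i, 0 ≤ ∑ j ∈ sens (idx i), x j := by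
    intro x hx i
    refine Finset.sum_nonneg fun j _ => ?_
    have hj := Fintype.mem_piFinset.1 hx j
    simp only [Finset.mem_insert, Finset.mem_singleton] at hj
    rcases hj with h | h <;> rw [h] <;> linarith
  rw [tendsto_iff_dist_tendsto_zero]
  refine squeeze_zero (fun T => dist_nonneg) (fun T => ?_) (g := fun T =>
    ∑ x ∈ inputSupport lam0 lam1, ∑ z ∈ (inputSupport lam0 lam1).erase x,
      exp (-∑ i, (√(T / c * ∑ j ∈ sens (idx i), x j)
        - √(T / c * ∑ j ∈ sens (idx i), z j)) ^ 2 / 2)) ?_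
  · rw [Real.dist_eq]
    refine (abs_measureMutualInfo_sub_measureEntropy_le (XLaw_restrict_inputSupport hp0 hp1 _ _)
      fun x => summable_sqrt_pi_poissonMeasure _).trans_eq ?_
    simp_rw [tsum_sqrt_pi_poissonMeasure_mul, htimes]
  · rw [show (0 : ℝ) = ∑ x ∈ inputSupport lam0 lam1,
      ∑ z ∈ (inputSupport lam0 lam1).erase x, 0 by simp]
    refine tendsto_finsetSum _ fun x hx => tendsto_finsetSum _ fun z hz => ?_
    obtain ⟨hzx, hz⟩ := Finset.mem_erase.1 hz
    refine (tendsto_exp_neg_sum_sqrt_mul (hnonneg x hx) (hnonneg z hz) fun h => ?_).comp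
      (tendsto_id.atTop_div_const hc)
    exact hzx (hinj x z fun i => congrFun h i).symm

end Sensing

/-- assuming `λ₀ > 0`, for each of the singlets, pairs, and triplets sensing
schemes the mutual information between `X` and the corresponding output vector tends to
the Shannon entropy `H(X₁,X₂,X₃,X₄)` as `T → ∞`. -/
theorem poisson_mutualInfo_tendsto_entropy
    (p lam0 lam1 : ℝ) (hlam0 : 0 < lam0) (hlam : lam0 < lam1) (hp0 : 0 < p) (hp1 : p < 1) :
    Tendsto (fun T : ℝ =>
        measureMutualInfo (poissonJointLaw p lam0 lam1
          (fun i => if i.val ≤ 3 then T / 4 else 0)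
          (fun i : Fin 4 => (⟨i.val, by omega⟩ : Fin 15))))
      atTop (nhds (measureEntropy (XLaw p lam0 lam1))) ∧
    Tendsto (fun T : ℝ =>
        measureMutualInfo (poissonJointLaw p lam0 lam1
          (fun i => if 4 ≤ i.val ∧ i.val ≤ 9 then T / 6 else 0)
          (fun i : Fin 6 => (⟨i.val + 4, by omega⟩ : Fin 15))))
      atTop (nhds (measureEntropy (XLaw p lam0 lam1))) ∧
    Tendsto (fun T : ℝ =>
        measureMutualInfo (poissonJointLaw p lam0 lam1
          (fun i => if 10 ≤ i.val ∧ i.val ≤ 13 then T / 4 else 0)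
          (fun i : Fin 4 => (⟨i.val + 10, by omega⟩ : Fin 15))))
      atTop (nhds (measureEntropy (XLaw p lam0 lam1))) := by
  refine ⟨?_, ?_, ?_⟩
  · refine tendsto_measureMutualInfo_poissonJointLaw hlam0 hlam hp0 hp1 _
      (fun T i => if i.val ≤ 3 then T / 4 else 0) (by norm_num : (0 : ℝ) < 4)
      (fun T i => if_pos (by simp; omega)) fun x z h => ?_
    simp only [Fin.forall_fin_succ] at h
    simp [sens] at h
    ext j
    fin_cases j <;> simp <;> linarith
  · refine tendsto_measureMutualInfo_poissonJointLaw hlam0 hlam hp0 hp1 _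
      (fun T i => if 4 ≤ i.val ∧ i.val ≤ 9 then T / 6 else 0) (by norm_num : (0 : ℝ) < 6)
      (fun T i => if_pos (by simp; omega)) fun x z h => ?_
    simp only [Fin.forall_fin_succ] at h
    simp [sens] at h
    ext j
    fin_cases j <;> simp <;> linarith
  · refine tendsto_measureMutualInfo_poissonJointLaw hlam0 hlam hp0 hp1 _
      (fun T i => if 10 ≤ i.val ∧ i.val ≤ 13 then T / 4 else 0) (by norm_num : (0 : ℝ) < 4)
      (fun T i => if_pos (by simp; omega)) fun x z h => ?_
    simp only [Fin.forall_fin_succ] at h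
    simp [sens] at h
    ext j
    fin_cases j <;> simp <;> linarith
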